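/- arXiv:2101.06178 — 2 statements merged into one kernel-verified Lean document; each statement's English description precedes it below -/
import Mathlib

section
/- Let b, δ ≥ 0, r a positive integer, and d, n positive integers with bd < 1. Let θ ∈ ℝⁿ and M an n×n symmetric matrix with M_{i,i} = 0 for all i, |M_{i,j}| ≤ b for all i, j, and each row of M having at most d nonzero entries. Let S ⊆ [n], v ∈ S, x ∈ {−1,1}ⁿ, and let G be the weighted graph on [n] with adjacency matrix M. Let S' ⊆ S be any subset of S that contains every vertex of S other than v that is connected to v in G by a path of length less than r in which every edge has weight of absolute value at least δ. Then for X ∼ I_{(M,θ)}, |P[X_v = 1 | X_{S∖{v}} = x_{S∖{v}}] − P[X_v = 1 | X_{S'} = x_{S'}]| ≤ (dδ + (bd)^r)/(1 − bd). -/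
open Finset Real
open scoped Classical

noncomputable section

/-- The real spin value (`±1`) of a Boolean configuration entry. -/
def spin (s : Bool) : ℝ := if s then 1 else -1

/-- The unnormalized Ising weight `exp(θ·x + ½ x·Mx)` of a configuration. -/
def isingWt {n : ℕ} (M : Matrix (Fin n) (Fin n) ℝ) (θ : Fin n → ℝ) (σ : Fin n → Bool) : ℝ :=
  Real.exp ((∑ i, θ i * spin (σ i)) + (1 / 2) * ∑ i, ∑ j, spin (σ i) * M i j * spin (σ j))

/-- The Ising probability of a single configuration. -/
def isingProb {n : ℕ} (M : Matrix (Fin n) (Fin n) ℝ) (θ : Fin n → ℝ) (σ : Fin n → Bool) : ℝ :=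
  isingWt M θ σ / ∑ τ : Fin n → Bool, isingWt M θ τ

/-- The Ising probability of an event `A`. -/
def isingPr {n : ℕ} (M : Matrix (Fin n) (Fin n) ℝ) (θ : Fin n → ℝ)
    (A : (Fin n → Bool) → Prop) : ℝ :=
  ∑ σ ∈ Finset.univ.filter (fun σ => A σ), isingProb M θ σ

/-- The Ising conditional probability `P[A | B]`. -/
def isingCond {n : ℕ} (M : Matrix (Fin n) (Fin n) ℝ) (θ : Fin n → ℝ)
    (A B : (Fin n → Bool) → Prop) : ℝ :=
  isingPr M θ (fun σ => A σ ∧ B σ) / isingPr M θ B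

/-- There is a path of positive length less than `r` from `v` to `u` in the weighted graph with
adjacency matrix `M`, all of whose edges have weight of absolute value at least `δ`. -/
def hasHeavyPath {n : ℕ} (M : Matrix (Fin n) (Fin n) ℝ) (δ : ℝ) (r : ℕ) (v u : Fin n) : Prop :=
  ∃ (k : ℕ) (p : ℕ → Fin n), 0 < k ∧ k < r ∧ p 0 = v ∧ p k = u ∧
    (∀ i < k, M (p i) (p (i + 1)) ≠ 0 ∧ δ ≤ |M (p i) (p (i + 1))|) ∧
    (∀ i ≤ k, ∀ j ≤ k, p i = p j → i = j)

/-! ### Oscillations and Dobrushin estimates -/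

/-- `c i` bounds the change of `f` when only the `i`-th coordinate is modified. -/
def OscLe {n : ℕ} (f : (Fin n → Bool) → ℝ) (c : Fin n → ℝ) : Prop :=
  ∀ i σ s, |f (Function.update σ i s) - f σ| ≤ c i

lemma OscLe.nonneg {n : ℕ} {f : (Fin n → Bool) → ℝ} {c : Fin n → ℝ} (h : OscLe f c)
    (i : Fin n) : 0 ≤ c i :=
  (abs_nonneg _).trans (h i (fun _ => true) true)

lemma OscLe.abs_sub_le_sum {n : ℕ} {f : (Fin n → Bool) → ℝ} {c : Fin n → ℝ} (h : OscLe f c)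
    (σ τ : Fin n → Bool) : |f σ - f τ| ≤ ∑ i, c i := by
  have key : ∀ s : Finset (Fin n), |f (s.piecewise σ τ) - f τ| ≤ ∑ i ∈ s, c i := by
    intro s
    induction s using Finset.induction_on with
    | empty => simp
    | insert i s hi ih =>
      rw [Finset.piecewise_insert, Finset.sum_insert hi]
      exact (abs_sub_le _ (f (s.piecewise σ τ)) _).trans (add_le_add (h i _ _) ih)
  simpa using key Finset.univ

/-- `a` controls the difference of the functionals `μ` and `ν` through oscillations. -/
def IsEstimate {n : ℕ} (μ ν : ((Fin n → Bool) → ℝ) → ℝ) (a : Fin n → ℝ) : Prop :=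
  ∀ f c, OscLe f c → |μ f - ν f| ≤ ∑ i, a i * c i

/-- There is an operator preserving `μ` and `ν` that removes the dependence on coordinate `i` and
increases the oscillation at `j` by at most `k j` times the oscillation at `i`. -/
def HasSmoothing {n : ℕ} (μ ν : ((Fin n → Bool) → ℝ) → ℝ) (i : Fin n) (k : Fin n → ℝ) : Prop :=
  ∀ f c, OscLe f c → ∃ g, μ g = μ f ∧ ν g = ν f ∧
    OscLe g (Function.update (fun j => c j + k j * c i) i 0)

lemma IsEstimate.update {n : ℕ} {μ ν : ((Fin n → Bool) → ℝ) → ℝ} {a k : Fin n → ℝ} {i : Fin n}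
    (ha : IsEstimate μ ν a) (ha0 : ∀ j, 0 ≤ a j) (hk : ∀ j, 0 ≤ k j) (h : HasSmoothing μ ν i k) :
    IsEstimate μ ν (Function.update a i (∑ j, k j * a j)) := by
  intro f c hf
  obtain ⟨g, hμ, hν, hg⟩ := h f c hf
  have hle := ha g _ hg
  rw [hμ, hν] at hle
  refine hle.trans ?_
  have hci := hf.nonneg i
  rw [← Finset.add_sum_erase _ _ (Finset.mem_univ i),
    ← Finset.add_sum_erase _ _ (Finset.mem_univ i)]
  simp only [Function.update_self, mul_zero, zero_add]
  have h1 : ∑ j ∈ univ.erase i, a j * Function.update (fun j => c j + k j * c i) i 0 j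
      = ∑ j ∈ univ.erase i, a j * c j + (∑ j ∈ univ.erase i, k j * a j) * c i := by
    rw [Finset.sum_mul, ← Finset.sum_add_distrib]
    refine Finset.sum_congr rfl fun j hj => ?_
    rw [Function.update_of_ne (Finset.ne_of_mem_erase hj)]
    ring
  have h2 : ∑ j ∈ univ.erase i, Function.update a i (∑ j, k j * a j) j * c j
      = ∑ j ∈ univ.erase i, a j * c j := by
    refine Finset.sum_congr rfl fun j hj => ?_
    rw [Function.update_of_ne (Finset.ne_of_mem_erase hj)]
  have h3 : ∑ j ∈ univ.erase i, k j * a j ≤ ∑ j, k j * a j :=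
    Finset.sum_le_sum_of_subset_of_nonneg (Finset.erase_subset _ _)
      fun j _ _ => mul_nonneg (hk j) (ha0 j)
  rw [h1, h2]
  nlinarith [mul_le_mul_of_nonneg_right h3 hci]

/-- A minimal estimate in the unit cube satisfies every inequality coming from a smoothing. -/
lemma exists_isEstimate_le_sum {n : ℕ} {μ ν : ((Fin n → Bool) → ℝ) → ℝ}
    (h1 : IsEstimate μ ν fun _ => 1) :
    ∃ a, IsEstimate μ ν a ∧ (∀ i, 0 ≤ a i) ∧ (∀ i, a i ≤ 1) ∧
      ∀ i k, (∀ j, 0 ≤ k j) → HasSmoothing μ ν i k → a i ≤ ∑ j, k j * a j := by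
  have hclosed : IsClosed {a : Fin n → ℝ | IsEstimate μ ν a} := by
    simp only [IsEstimate, Set.ofPred_forall]
    refine isClosed_iInter fun f => isClosed_iInter fun c => isClosed_iInter fun _ => ?_
    exact isClosed_le continuous_const (by fun_prop)
  have hcompact : IsCompact (Set.Icc (0 : Fin n → ℝ) 1 ∩ {a | IsEstimate μ ν a}) :=
    isCompact_Icc.inter_right hclosed
  obtain ⟨a, ⟨⟨ha0, ha1⟩, ha⟩, hmin⟩ := hcompact.exists_isMinOn
    ⟨1, ⟨zero_le_one, le_rfl⟩, h1⟩
    (f := fun a => ∑ i, a i) (Continuous.continuousOn (by fun_prop))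
  refine ⟨a, ha, ha0, ha1, fun i k hk hs => ?_⟩
  by_contra! hlt
  have hnn : 0 ≤ ∑ j, k j * a j := Finset.sum_nonneg fun j _ => mul_nonneg (hk j) (ha0 j)
  have hmem : Function.update a i (∑ j, k j * a j) ∈
      Set.Icc (0 : Fin n → ℝ) 1 ∩ {a | IsEstimate μ ν a} := by
    refine ⟨⟨?_, ?_⟩, IsEstimate.update ha ha0 hk hs⟩
    · exact le_update_iff.2 ⟨hnn, fun j _ => ha0 j⟩
    · exact update_le_iff.2 ⟨hlt.le.trans (ha1 i), fun j _ => ha1 j⟩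
  have hle : ∑ j, a j ≤ ∑ j, Function.update a i (∑ j, k j * a j) j := hmin hmem
  rw [Finset.sum_update_of_mem (Finset.mem_univ i),
    ← Finset.add_sum_erase _ _ (Finset.mem_univ i), Finset.sdiff_singleton_eq_erase] at hle
  linarith

/-! ### Conditional expectations of the Ising model -/

lemma isingWt_pos {n : ℕ} (M : Matrix (Fin n) (Fin n) ℝ) (θ : Fin n → ℝ) (σ : Fin n → Bool) :
    0 < isingWt M θ σ :=
  Real.exp_pos _

/-- The conditional expectation of `f` given the event `B`. -/
def isingCondExp {n : ℕ} (M : Matrix (Fin n) (Fin n) ℝ) (θ : Fin n → ℝ)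
    (B : (Fin n → Bool) → Prop) (f : (Fin n → Bool) → ℝ) : ℝ :=
  (∑ σ with B σ, isingWt M θ σ * f σ) / ∑ σ with B σ, isingWt M θ σ

lemma isingCond_eq_isingCondExp {n : ℕ} (M : Matrix (Fin n) (Fin n) ℝ) (θ : Fin n → ℝ)
    (A B : (Fin n → Bool) → Prop) [DecidablePred A] :
    isingCond M θ A B = isingCondExp M θ B fun σ => if A σ then 1 else 0 := by
  have hZ : 0 < ∑ τ, isingWt M θ τ :=
    Finset.sum_pos (fun σ _ => isingWt_pos M θ σ) Finset.univ_nonempty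
  simp only [isingCond, isingPr, isingProb, isingCondExp, ← Finset.sum_div]
  rw [div_div_div_cancel_right₀ hZ.ne']
  congr 1
  simp only [mul_ite, mul_one, mul_zero]
  rw [← Finset.sum_filter, Finset.filter_filter]
  simp only [and_comm]

lemma isingCondExp_le {n : ℕ} {M : Matrix (Fin n) (Fin n) ℝ} {θ : Fin n → ℝ}
    {B : (Fin n → Bool) → Prop} (hB : ∃ σ, B σ) {f : (Fin n → Bool) → ℝ} {C : ℝ}
    (h : ∀ σ, f σ ≤ C) : isingCondExp M θ B f ≤ C := by
  obtain ⟨σ₀, h0⟩ := hB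
  have hpos : 0 < ∑ σ with B σ, isingWt M θ σ :=
    Finset.sum_pos (fun σ _ => isingWt_pos M θ σ) ⟨σ₀, by simpa using h0⟩
  rw [isingCondExp, div_le_iff₀ hpos, mul_comm, Finset.sum_mul]
  exact Finset.sum_le_sum fun σ _ => mul_le_mul_of_nonneg_left (h σ) (isingWt_pos M θ σ).le

lemma le_isingCondExp {n : ℕ} {M : Matrix (Fin n) (Fin n) ℝ} {θ : Fin n → ℝ}
    {B : (Fin n → Bool) → Prop} (hB : ∃ σ, B σ) {f : (Fin n → Bool) → ℝ} {C : ℝ}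
    (h : ∀ σ, C ≤ f σ) : C ≤ isingCondExp M θ B f := by
  obtain ⟨σ₀, h0⟩ := hB
  have hpos : 0 < ∑ σ with B σ, isingWt M θ σ :=
    Finset.sum_pos (fun σ _ => isingWt_pos M θ σ) ⟨σ₀, by simpa using h0⟩
  rw [isingCondExp, le_div_iff₀ hpos, mul_comm, Finset.sum_mul]
  exact Finset.sum_le_sum fun σ _ => mul_le_mul_of_nonneg_left (h σ) (isingWt_pos M θ σ).le

lemma isEstimate_one_isingCondExp {n : ℕ} (M : Matrix (Fin n) (Fin n) ℝ) (θ : Fin n → ℝ)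
    {B B' : (Fin n → Bool) → Prop} (hB : ∃ σ, B σ) (hB' : ∃ σ, B' σ) :
    IsEstimate (isingCondExp M θ B) (isingCondExp M θ B') fun _ => 1 := by
  intro f c hf
  simp only [one_mul]
  have key : ∀ σ τ, f σ ≤ (∑ i, c i) + f τ := fun σ τ => by
    linarith [le_of_abs_le (hf.abs_sub_le_sum σ τ)]
  have h1 : isingCondExp M θ B f - ∑ i, c i ≤ isingCondExp M θ B' f :=
    le_isingCondExp hB' fun τ => by linarith [isingCondExp_le (M := M) (θ := θ) hB (key · τ)]
  have h2 : isingCondExp M θ B' f - ∑ i, c i ≤ isingCondExp M θ B f :=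
    le_isingCondExp hB fun τ => by linarith [isingCondExp_le (M := M) (θ := θ) hB' (key · τ)]
  rw [abs_le]
  constructor <;> linarith

/-! ### Pinned coordinates -/

lemma isingCondExp_update_of_pinned {n : ℕ} (M : Matrix (Fin n) (Fin n) ℝ) (θ : Fin n → ℝ)
    {B : (Fin n → Bool) → Prop} {i : Fin n} {s : Bool} (hB : ∀ σ, B σ → σ i = s)
    (f : (Fin n → Bool) → ℝ) :
    isingCondExp M θ B (fun σ => f (Function.update σ i s)) = isingCondExp M θ B f := by
  simp only [isingCondExp]
  congr 1
  refine Finset.sum_congr rfl fun σ hσ => ?_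
  rw [← hB σ (by simpa using hσ), Function.update_eq_self]

lemma hasSmoothing_of_pinned {n : ℕ} (M : Matrix (Fin n) (Fin n) ℝ) (θ : Fin n → ℝ)
    {B B' : (Fin n → Bool) → Prop} {i : Fin n} {s : Bool} (hB : ∀ σ, B σ → σ i = s)
    (hB' : ∀ σ, B' σ → σ i = s) :
    HasSmoothing (isingCondExp M θ B) (isingCondExp M θ B') i fun _ => 0 := by
  intro f c hf
  refine ⟨fun σ => f (Function.update σ i s), isingCondExp_update_of_pinned M θ hB f,
    isingCondExp_update_of_pinned M θ hB' f, fun j σ t => ?_⟩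
  by_cases hj : j = i
  · subst hj
    simp
  · simpa [hj, Function.update_comm hj] using hf j (Function.update σ i s) t

/-! ### Free coordinates -/

lemma abs_sigmoid_sub_le (x y : ℝ) : |sigmoid x - sigmoid y| ≤ |x - y| / 4 := by
  have h := Convex.norm_image_sub_le_of_norm_deriv_le (f := sigmoid) (C := 1 / 4) (s := Set.univ)
    (x := y) (y := x) (fun z _ => differentiable_sigmoid z) (fun z _ => by
      rw [deriv_sigmoid, Real.norm_eq_abs, abs_le]
      have := sigmoid_pos z
      have := sigmoid_lt_one z
      constructor <;> nlinarith [sq_nonneg (sigmoid z - 1 / 2)])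
    convex_univ (Set.mem_univ _) (Set.mem_univ _)
  simp only [Real.norm_eq_abs] at h
  linarith

/-- The log-odds of the spin at `i` given all the other spins. -/
def logOdds {n : ℕ} (M : Matrix (Fin n) (Fin n) ℝ) (θ : Fin n → ℝ) (i : Fin n)
    (σ : Fin n → Bool) : ℝ :=
  2 * (θ i + ∑ j, M i j * spin (σ j))

lemma logOdds_update {n : ℕ} (M : Matrix (Fin n) (Fin n) ℝ) (θ : Fin n → ℝ) (i j : Fin n)
    (σ : Fin n → Bool) (s : Bool) :
    logOdds M θ i (Function.update σ j s) =
      logOdds M θ i σ + 2 * M i j * (spin s - spin (σ j)) := by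
  have h : ∀ l, M i l * spin (Function.update σ j s l) =
      M i l * spin (σ l) + if l = j then M i j * (spin s - spin (σ j)) else 0 := by
    intro l
    by_cases hl : l = j
    · subst hl
      simp
      ring
    · simp [hl]
  simp only [logOdds, h, Finset.sum_add_distrib, Finset.sum_ite_eq', Finset.mem_univ, if_true]
  ring

lemma abs_spin_sub_le (s t : Bool) : |spin s - spin t| ≤ 2 := by
  cases s <;> cases t <;> norm_num [spin]

lemma abs_sigmoid_logOdds_update_sub_le {n : ℕ} (M : Matrix (Fin n) (Fin n) ℝ) (θ : Fin n → ℝ)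
    (i j : Fin n) (σ : Fin n → Bool) (s : Bool) :
    |sigmoid (logOdds M θ i (Function.update σ j s)) - sigmoid (logOdds M θ i σ)| ≤ |M i j| := by
  refine (abs_sigmoid_sub_le _ _).trans ?_
  rw [logOdds_update, add_sub_cancel_left, abs_mul, abs_mul, abs_two]
  nlinarith [mul_le_mul_of_nonneg_left (abs_spin_sub_le s (σ j)) (abs_nonneg (M i j))]

lemma isingWt_update_true {n : ℕ} {M : Matrix (Fin n) (Fin n) ℝ} (θ : Fin n → ℝ)
    (hsymm : M.IsSymm) {i : Fin n} (hdiag : M i i = 0) (σ : Fin n → Bool) :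
    isingWt M θ (Function.update σ i true) =
      isingWt M θ (Function.update σ i false) * Real.exp (logOdds M θ i σ) := by
  have hlog : logOdds M θ i σ = logOdds M θ i (Function.update σ i false) := by
    simp [logOdds_update, hdiag]
  have h : ∀ j, spin (Function.update σ i true j) =
      spin (Function.update σ i false j) + if j = i then 2 else 0 := by
    intro j
    by_cases hj : j = i
    · subst hj
      norm_num [spin]
    · simp [hj]
  rw [hlog, isingWt, isingWt, ← Real.exp_add]
  congr 1
  simp only [h, logOdds]
  generalize hl : (fun j => spin (Function.update σ i false j)) = l
  replace hl : ∀ j, spin (Function.update σ i false j) = l j := fun j => by rw [← hl]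
  simp only [hl, mul_add, add_mul, Finset.sum_add_distrib, mul_ite, ite_mul, mul_zero, zero_mul,
    Finset.sum_ite_eq', Finset.mem_univ, if_true, hdiag, Finset.sum_ite_irrel,
    Finset.sum_const_zero]
  have h1 : ∑ k, l k * M k i * 2 = 2 * ∑ k, M i k * l k := by
    rw [Finset.mul_sum]
    exact Finset.sum_congr rfl fun k _ => by rw [hsymm.apply]; ring
  have h2 : ∑ k, 2 * M i k * l k = 2 * ∑ k, M i k * l k := by
    rw [Finset.mul_sum]
    exact Finset.sum_congr rfl fun k _ => by ring
  rw [h1, h2]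
  ring

/-- Average `f` over the spin at `i` given all the other spins. -/
def resample {n : ℕ} (M : Matrix (Fin n) (Fin n) ℝ) (θ : Fin n → ℝ) (i : Fin n)
    (f : (Fin n → Bool) → ℝ) (σ : Fin n → Bool) : ℝ :=
  sigmoid (logOdds M θ i σ) * f (Function.update σ i true) +
    (1 - sigmoid (logOdds M θ i σ)) * f (Function.update σ i false)

lemma resample_update_self {n : ℕ} {M : Matrix (Fin n) (Fin n) ℝ} (θ : Fin n → ℝ) {i : Fin n}
    (hdiag : M i i = 0) (f : (Fin n → Bool) → ℝ) (σ : Fin n → Bool) (s : Bool) :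
    resample M θ i f (Function.update σ i s) = resample M θ i f σ := by
  simp [resample, logOdds_update, hdiag]

lemma oscLe_resample {n : ℕ} {M : Matrix (Fin n) (Fin n) ℝ} (θ : Fin n → ℝ) {i : Fin n}
    (hdiag : M i i = 0) {f : (Fin n → Bool) → ℝ} {c : Fin n → ℝ} (hf : OscLe f c) :
    OscLe (resample M θ i f) (Function.update (fun j => c j + |M i j| * c i) i 0) := by
  intro j σ s
  by_cases hj : j = i
  · subst hj
    simp [resample_update_self θ hdiag]
  rw [Function.update_of_ne hj]
  have hA := hf j (Function.update σ i true) s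
  have hB := hf j (Function.update σ i false) s
  rw [Function.update_comm (Ne.symm hj)] at hA hB
  have hAB := hf i (Function.update σ i false) true
  rw [Function.update_idem] at hAB
  have hp := abs_sigmoid_logOdds_update_sub_le M θ i j σ s
  simp only [resample]
  set p := sigmoid (logOdds M θ i σ)
  have hq0 := sigmoid_pos (logOdds M θ i (Function.update σ j s))
  have hq1 := sigmoid_lt_one (logOdds M θ i (Function.update σ j s))
  set q := sigmoid (logOdds M θ i (Function.update σ j s))
  set A := f (Function.update σ i true)
  set B := f (Function.update σ i false)
  set A' := f (Function.update (Function.update σ j s) i true)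
  set B' := f (Function.update (Function.update σ j s) i false)
  calc |q * A' + (1 - q) * B' - (p * A + (1 - p) * B)|
      = |q * (A' - A) + (1 - q) * (B' - B) + (q - p) * (A - B)| := by ring_nf
    _ ≤ |q * (A' - A)| + |(1 - q) * (B' - B)| + |(q - p) * (A - B)| := abs_add_three _ _ _
    _ = q * |A' - A| + (1 - q) * |B' - B| + |q - p| * |A - B| := by
        rw [abs_mul, abs_mul, abs_mul, abs_of_pos hq0, abs_of_pos (sub_pos.2 hq1)]
    _ ≤ q * c j + (1 - q) * c j + |M i j| * c i := by
        have := sub_nonneg.2 hq1.le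
        gcongr
    _ = c j + |M i j| * c i := by ring

lemma isingWt_mul_resample {n : ℕ} {M : Matrix (Fin n) (Fin n) ℝ} (θ : Fin n → ℝ)
    (hsymm : M.IsSymm) {i : Fin n} (hdiag : M i i = 0) (f : (Fin n → Bool) → ℝ)
    (σ : Fin n → Bool) :
    (isingWt M θ (Function.update σ i true) + isingWt M θ (Function.update σ i false)) *
        resample M θ i f σ =
      isingWt M θ (Function.update σ i true) * f (Function.update σ i true) +
        isingWt M θ (Function.update σ i false) * f (Function.update σ i false) := by
  rw [isingWt_update_true θ hsymm hdiag, resample, sigmoid_def, Real.exp_neg]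
  have := Real.exp_pos (logOdds M θ i σ)
  field_simp
  ring

lemma isingCondExp_resample {n : ℕ} {M : Matrix (Fin n) (Fin n) ℝ} (θ : Fin n → ℝ)
    (hsymm : M.IsSymm) {i : Fin n} (hdiag : M i i = 0) {B : (Fin n → Bool) → Prop}
    (hB : ∀ σ s, B (Function.update σ i s) ↔ B σ) (f : (Fin n → Bool) → ℝ) :
    isingCondExp M θ B (resample M θ i f) = isingCondExp M θ B f := by
  simp only [isingCondExp]
  congr 1
  have hinv : Function.Involutive fun σ : Fin n → Bool => Function.update σ i (!σ i) :=
    fun σ => by simp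
  have hsum : ∀ g : (Fin n → Bool) → ℝ, 2 * ∑ σ with B σ, g σ =
      ∑ σ with B σ, (g (Function.update σ i true) + g (Function.update σ i false)) := by
    intro g
    have hflip : ∑ σ with B σ, g (Function.update σ i (!σ i)) = ∑ σ with B σ, g σ := by
      rw [Finset.sum_filter, Finset.sum_filter, ← Equiv.sum_comp hinv.toPerm]
      exact Finset.sum_congr rfl fun σ _ => by simp [hB]
    rw [two_mul]
    nth_rewrite 2 [← hflip]
    rw [← Finset.sum_add_distrib]
    refine Finset.sum_congr rfl fun σ _ => ?_
    nth_rewrite 1 [← Function.update_eq_self i σ]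
    cases σ i
    · simp [add_comm]
    · simp
  refine mul_left_cancel₀ (two_ne_zero (α := ℝ)) ?_
  rw [hsum, hsum]
  refine Finset.sum_congr rfl fun σ _ => ?_
  rw [resample_update_self θ hdiag, resample_update_self θ hdiag, ← add_mul,
    isingWt_mul_resample θ hsymm hdiag]

lemma hasSmoothing_of_free {n : ℕ} {M : Matrix (Fin n) (Fin n) ℝ} (θ : Fin n → ℝ)
    (hsymm : M.IsSymm) {i : Fin n} (hdiag : M i i = 0) {B B' : (Fin n → Bool) → Prop}
    (hB : ∀ σ s, B (Function.update σ i s) ↔ B σ)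
    (hB' : ∀ σ s, B' (Function.update σ i s) ↔ B' σ) :
    HasSmoothing (isingCondExp M θ B) (isingCondExp M θ B') i fun j => |M i j| :=
  fun f _ hf => ⟨resample M θ i f, isingCondExp_resample θ hsymm hdiag hB f,
    isingCondExp_resample θ hsymm hdiag hB' f, oscLe_resample θ hdiag hf⟩

/-! ### Propagation along heavy walks -/

/-- The graph of the edges of weight at least `δ` in absolute value. -/
def heavyGraph {n : ℕ} {M : Matrix (Fin n) (Fin n) ℝ} (hsymm : M.IsSymm)
    (hdiag : ∀ i, M i i = 0) (δ : ℝ) : SimpleGraph (Fin n) where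
  Adj i j := M i j ≠ 0 ∧ δ ≤ |M i j|
  symm := ⟨fun i j h => by rwa [hsymm.apply i j]⟩
  loopless := ⟨fun i h => h.1 (hdiag i)⟩

lemma hasHeavyPath_of_walk {n : ℕ} {M : Matrix (Fin n) (Fin n) ℝ} (hsymm : M.IsSymm)
    (hdiag : ∀ i, M i i = 0) {δ : ℝ} {r : ℕ} {v u : Fin n}
    (p : (heavyGraph hsymm hdiag δ).Walk v u) (hp : p.length < r) (huv : u ≠ v) :
    hasHeavyPath M δ r v u := by
  have hpath := p.bypass_isPath
  refine ⟨p.bypass.length, p.bypass.getVert, ?_, p.length_bypass_le_length.trans_lt hp,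
    p.bypass.getVert_zero, p.bypass.getVert_length, fun i hi => p.bypass.adj_getVert_succ hi,
    fun i hi j hj h => hpath.getVert_injOn hi hj h⟩
  by_contra h0
  exact huv (SimpleGraph.Walk.eq_of_length_eq_zero (p := p.bypass) (by omega)).symm

lemma sum_abs_mul_le {n : ℕ} {b δ q : ℝ} {d : ℕ} (hδ : 0 ≤ δ) (hq : 0 ≤ q)
    {m a : Fin n → ℝ} (hbound : ∀ j, |m j| ≤ b) (hsparse : #{j | m j ≠ 0} ≤ d)
    (ha0 : ∀ j, 0 ≤ a j) (ha1 : ∀ j, a j ≤ 1) (hb : 0 ≤ b)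
    (ha : ∀ j, m j ≠ 0 → δ ≤ |m j| → a j ≤ q) :
    ∑ j, |m j| * a j ≤ d * (δ + b * q) := by
  have hterm : ∀ j ∈ ({j | m j ≠ 0} : Finset (Fin n)), |m j| * a j ≤ δ + b * q := by
    intro j hj
    have hj' : m j ≠ 0 := by simpa using hj
    by_cases h : δ ≤ |m j|
    · linarith [mul_le_mul (hbound j) (ha j hj' h) (ha0 j) hb]
    · linarith [mul_le_mul (not_le.1 h).le (ha1 j) (ha0 j) hδ, mul_nonneg hb hq]
  calc ∑ j, |m j| * a j = ∑ j with m j ≠ 0, |m j| * a j := by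
        refine (Finset.sum_filter_of_ne fun j _ h => ?_).symm
        exact abs_ne_zero.1 (left_ne_zero_of_mul h)
    _ ≤ #{j | m j ≠ 0} • (δ + b * q) := Finset.sum_le_card_nsmul _ _ _ hterm
    _ ≤ d * (δ + b * q) := by
        rw [nsmul_eq_mul]
        have : (#{j | m j ≠ 0} : ℝ) ≤ d := by exact_mod_cast hsparse
        exact mul_le_mul_of_nonneg_right this (by positivity)

lemma le_of_heavy_walk {n : ℕ} {b δ : ℝ} {d r : ℕ} (hb : 0 ≤ b) (hδ : 0 ≤ δ) (hbd : b * d < 1)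
    {M : Matrix (Fin n) (Fin n) ℝ} (hsymm : M.IsSymm) (hdiag : ∀ i, M i i = 0)
    (hbound : ∀ i j, |M i j| ≤ b) (hsparse : ∀ i, #{j | M i j ≠ 0} ≤ d)
    {a : Fin n → ℝ} (ha0 : ∀ i, 0 ≤ a i) (ha1 : ∀ i, a i ≤ 1) {v : Fin n}
    (ha : ∀ (u : Fin n) (p : (heavyGraph hsymm hdiag δ).Walk v u), p.length < r →
      a u ≤ ∑ j, |M u j| * a j) :
    a v ≤ d * δ / (1 - b * d) + (b * d) ^ r := by
  have hpos : 0 < 1 - b * d := by linarith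
  have hK : 0 ≤ d * δ / (1 - b * d) := by positivity
  suffices H : ∀ (m : ℕ) (u : Fin n) (p : (heavyGraph hsymm hdiag δ).Walk v u),
      m + p.length = r → a u ≤ d * δ / (1 - b * d) + (b * d) ^ m from
    H r v .nil (by simp)
  intro m
  induction m with
  | zero =>
    intro u p _
    linarith [ha1 u, pow_zero (b * (d : ℝ))]
  | succ m ih =>
    intro u p hp
    refine (ha u p (by omega)).trans ?_
    have hle := sum_abs_mul_le (q := d * δ / (1 - b * d) + (b * d) ^ m) hδ (by positivity)
      (hbound u) (hsparse u) ha0 ha1 hb fun j hj0 hjδ => by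
        have hadj : (heavyGraph hsymm hdiag δ).Adj u j := ⟨hj0, hjδ⟩
        exact ih j (p.concat hadj) (by rw [SimpleGraph.Walk.length_concat]; omega)
    refine hle.trans_eq ?_
    have hfix := div_mul_cancel₀ (d * δ) hpos.ne'
    rw [pow_succ]
    linear_combination -hfix

/-- If `S' ⊆ S` contains every vertex of `S` other than `v` connected to `v` by a
path of length `< r` all of whose edges have weight of absolute value `≥ δ`, then conditioning on
`S'` is almost as good as conditioning on all of `S ∖ {v}`. -/
theorem stmt3 {n : ℕ} (b δ : ℝ) (d r : ℕ) (hb : 0 ≤ b) (hδ : 0 ≤ δ)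
    (hd : 0 < d) (hr : 0 < r) (hn : 0 < n) (hbd : b * d < 1)
    (M : Matrix (Fin n) (Fin n) ℝ) (θ : Fin n → ℝ)
    (hsymm : M.IsSymm) (hdiag : ∀ i, M i i = 0)
    (hbound : ∀ i j, |M i j| ≤ b)
    (hsparse : ∀ i, (Finset.univ.filter (fun j => M i j ≠ 0)).card ≤ d)
    (S S' : Finset (Fin n)) (v : Fin n) (hvS : v ∈ S) (x : Fin n → Bool)
    (hS'S : S' ⊆ S) (hvS' : v ∉ S')
    (hS' : ∀ u ∈ S, u ≠ v → hasHeavyPath M δ r v u → u ∈ S') :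
    |isingCond M θ (fun σ => σ v = true) (fun σ => ∀ w ∈ S, w ≠ v → σ w = x w) -
      isingCond M θ (fun σ => σ v = true) (fun σ => ∀ w ∈ S', σ w = x w)|
      ≤ (d * δ + (b * d) ^ r) / (1 - b * d) := by
  set B : (Fin n → Bool) → Prop := fun σ => ∀ w ∈ S, w ≠ v → σ w = x w
  set B' : (Fin n → Bool) → Prop := fun σ => ∀ w ∈ S', σ w = x w
  obtain ⟨a, ha, ha0, ha1, hsmooth⟩ := exists_isEstimate_le_sum
    (isEstimate_one_isingCondExp M θ (B := B) (B' := B') ⟨x, fun _ _ _ => rfl⟩ ⟨x, fun _ _ => rfl⟩)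
  have hle : ∀ (u : Fin n) (p : (heavyGraph hsymm hdiag δ).Walk v u), p.length < r →
      a u ≤ ∑ j, |M u j| * a j := by
    intro u p hp
    by_cases hu : u ∈ S'
    · have huv : u ≠ v := fun h => hvS' (h ▸ hu)
      have h0 := hsmooth u (fun _ => 0) (fun _ => le_rfl)
        (hasSmoothing_of_pinned M θ (s := x u) (fun σ h => h u (hS'S hu) huv) fun σ h => h u hu)
      simp only [zero_mul, Finset.sum_const_zero] at h0
      exact h0.trans (Finset.sum_nonneg fun j _ => mul_nonneg (abs_nonneg _) (ha0 j))
    · have huS : u ∈ S → u = v := fun h => by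
        by_contra huv
        exact hu (hS' u h huv (hasHeavyPath_of_walk hsymm hdiag p hp huv))
      refine hsmooth u (fun j => |M u j|) (fun _ => abs_nonneg _)
        (hasSmoothing_of_free θ hsymm (hdiag u) (fun σ s => ?_) fun σ s => ?_)
      · refine forall₃_congr fun w hw hwv => ?_
        have hwu : w ≠ u := fun h => hwv (h.trans (huS (h ▸ hw)))
        rw [Function.update_of_ne hwu]
      · refine forall₂_congr fun w hw => ?_
        have hwu : w ≠ u := fun h => hu (h ▸ hw)
        rw [Function.update_of_ne hwu]
  have hav := le_of_heavy_walk hb hδ hbd hsymm hdiag hbound hsparse ha0 ha1 hle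
  have hosc : OscLe (fun σ : Fin n → Bool => if σ v = true then (1 : ℝ) else 0)
      (Pi.single v 1) := by
    intro j σ s
    by_cases hj : j = v
    · subst hj
      cases s <;> cases h : σ j <;> simp [h]
    · simp [hj, Function.update_of_ne (Ne.symm hj)]
  have hdiff := ha _ _ hosc
  simp only [Pi.single_apply, mul_ite, mul_one, mul_zero, Finset.sum_ite_eq', Finset.mem_univ,
    if_true] at hdiff
  rw [isingCond_eq_isingCondExp, isingCond_eq_isingCondExp]
  refine hdiff.trans (hav.trans ?_)
  rw [add_div]
  have hpos : 0 < 1 - b * d := by linarith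
  have hbd0 : 0 ≤ b * d := by positivity
  gcongr
  exact le_div_self (by positivity) hpos (by linarith)
end
end

section
/- Let b > 0 and k a positive integer, and let X be drawn from the Ising model on the weighted graph H_{b[k]} with all biases equal to 0. Then for every x ∈ {−1,1}^{2k+2}, the probability that the 2k+2 focus vertices of H_{b[k]} take on the values given by x equals 2^{−(2k+2)}·(1 + δ_b^k·∏_{i=1}^{2k+2} x_i), where δ_b = sinh⁴(2b)/(2cosh⁴(2b) − sinh⁴(2b)). -/
open Finset Real
open scoped Classical

noncomputable section

/-- `δ_b = sinh⁴(2b)/(2cosh⁴(2b) − sinh⁴(2b))`. -/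
def deltab (b : ℝ) : ℝ :=
  Real.sinh (2 * b) ^ 4 / (2 * Real.cosh (2 * b) ^ 4 - Real.sinh (2 * b) ^ 4)

/-- The vertex of `H_{b[k]}` playing the role `i ∈ {v₁,v₂,v₃,v₄}` in copy `c`.  Vertices
`0,…,k` are the shared vertices `w₀,…,w_k`; vertices `k+1+6c` and `k+1+6c+1` are `v₂,v₃` of copy
`c`; role `v₁` of copy `c` is `w_c` and role `v₄` of copy `c` is `w_{c+1}`. -/
def vRole (k : ℕ) (c : Fin k) (i : Fin 4) : Fin (7 * k + 1) :=
  if i.val = 0 then ⟨c.val, by have := c.isLt; omega⟩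
  else if i.val = 1 then ⟨k + 1 + 6 * c.val, by have := c.isLt; omega⟩
  else if i.val = 2 then ⟨k + 1 + 6 * c.val + 1, by have := c.isLt; omega⟩
  else ⟨c.val + 1, by have := c.isLt; omega⟩

/-- The vertex of `H_{b[k]}` playing the role `u_{j+1}` in copy `c`. -/
def uRole (k : ℕ) (c : Fin k) (j : Fin 4) : Fin (7 * k + 1) :=
  ⟨k + 1 + 6 * c.val + 2 + j.val, by have := c.isLt; have := j.isLt; omega⟩

/-- The weighted adjacency matrix of `H_{b[k]}`: `k` copies of the gadget `H_b`, the `v₄` of copy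
`c` identified with the `v₁` of copy `c+1`; within each copy, `v_i u_i`-edges have weight `b` and
`v_i u_j`-edges (`j ≠ i`) weight `-b`. -/
def Hbk (b : ℝ) (k : ℕ) : Matrix (Fin (7 * k + 1)) (Fin (7 * k + 1)) ℝ := fun p q =>
  ∑ c : Fin k, ∑ i : Fin 4, ∑ j : Fin 4,
    if (p = vRole k c i ∧ q = uRole k c j) ∨ (p = uRole k c j ∧ q = vRole k c i)
    then (if i = j then b else -b) else 0

/-- The `2k+2` focus vertices of `H_{b[k]}`: the shared end vertices `w₀, w_k` together with the
`v₂,v₃` vertices of every copy. -/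
def focusSet (k : ℕ) : Finset (Fin (7 * k + 1)) :=
  Finset.univ.filter (fun p =>
    p.val = 0 ∨ p.val = k ∨ ∃ c < k, p.val = k + 1 + 6 * c ∨ p.val = k + 1 + 6 * c + 1)

theorem sum_fin_succ_fun {n : ℕ} (F : (Fin (n + 1) → Bool) → ℝ) :
    ∑ p, F p = ∑ a, ∑ q : Fin n → Bool, F (Fin.cons a q) := by
  rw [← (Fin.consEquiv (fun _ : Fin (n + 1) => Bool)).sum_comp, Fintype.sum_prod_type]
  rfl

/-- Transfer-matrix evaluation of a chain of spins with arbitrary boundary weights. -/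
theorem sum_spin_chain {k : ℕ} (f g : Bool → ℝ) (α z : Fin k → ℝ) :
    ∑ w : Fin (k + 1) → Bool, f (w 0) * g (w (Fin.last k)) *
        ∏ c, (α c + z c * spin (w c.castSucc) * spin (w c.succ)) =
      2 ^ k / 2 * ((∑ a, f a) * (∑ a, g a) * ∏ c, α c +
        (∑ a, spin a * f a) * (∑ a, spin a * g a) * ∏ c, z c) := by
  induction k generalizing f with
  | zero =>
    rw [sum_fin_succ_fun]
    simp [spin]
    ring
  | succ k ih =>
    have key := ih (fun a' => ∑ a, f a * (α 0 + z 0 * spin a * spin a'))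
      (fun c => α c.succ) (fun c => z c.succ)
    rw [sum_fin_succ_fun, Finset.sum_comm]
    have : ∀ q : Fin (k + 1) → Bool,
        ∑ a, f ((Fin.cons a q : Fin (k + 2) → Bool) 0) *
          g ((Fin.cons a q : Fin (k + 2) → Bool) (Fin.last (k + 1))) *
          ∏ c : Fin (k + 1), (α c + z c * spin ((Fin.cons a q : Fin (k + 2) → Bool) c.castSucc) *
            spin ((Fin.cons a q : Fin (k + 2) → Bool) c.succ)) =
        (∑ a, f a * (α 0 + z 0 * spin a * spin (q 0))) * g (q (Fin.last k)) *
          ∏ c : Fin k, (α c.succ + z c.succ * spin (q c.castSucc) * spin (q c.succ)) := by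
      intro q
      rw [Finset.sum_mul, Finset.sum_mul]
      refine Finset.sum_congr rfl fun a _ => ?_
      rw [Fin.prod_univ_succ, ← Fin.succ_last]
      simp only [Fin.cons_zero, Fin.cons_succ, Fin.castSucc_zero, ← Fin.succ_castSucc]
      ring
    rw [Finset.sum_congr rfl fun q _ => this q, key, Fin.prod_univ_succ, Fin.prod_univ_succ]
    simp [spin]
    ring

theorem deltab_den_pos (b : ℝ) : 0 < 2 * cosh (2 * b) ^ 4 - sinh (2 * b) ^ 4 := by
  have h := cosh_sq (2 * b)
  have h4 : cosh (2 * b) ^ 4 = (sinh (2 * b) ^ 2 + 1) ^ 2 := by rw [← h]; ring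
  rw [h4]
  nlinarith [sq_nonneg (sinh (2 * b)), sq_nonneg (sinh (2 * b) ^ 2)]

/-- The coupling between the `i`-th focus vertex and the `j`-th background vertex of `H_b`. -/
def gadgetEnergy (b : ℝ) (v u : Fin 4 → Bool) : ℝ :=
  ∑ i, ∑ j, (if i = j then b else -b) * spin (v i) * spin (u j)

/-- Summing out the background vertices of `H_b`. -/
theorem sum_exp_gadgetEnergy (b : ℝ) (v : Fin 4 → Bool) :
    ∑ u : Fin 4 → Bool, exp (gadgetEnergy b v u) =
      8 * (2 * cosh (2 * b) ^ 4 - sinh (2 * b) ^ 4) *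
        (1 + deltab b * (spin (v 0) * spin (v 1) * spin (v 2) * spin (v 3))) := by
  have hsum : ∑ u : Fin 4 → Bool, exp (gadgetEnergy b v u) =
      ∏ j : Fin 4, (2 * cosh (∑ i, (if i = j then b else -b) * spin (v i))) := by
    have h1 : ∀ j : Fin 4, 2 * cosh (∑ i, (if i = j then b else -b) * spin (v i)) =
        ∑ a : Bool, exp ((∑ i, (if i = j then b else -b) * spin (v i)) * spin a) := by
      intro j
      rw [cosh_eq]
      simp [spin]
      ring
    simp_rw [h1]
    rw [Finset.prod_univ_sum, Fintype.piFinset_univ]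
    refine Finset.sum_congr rfl fun u _ => ?_
    rw [← exp_sum, gadgetEnergy, Finset.sum_comm]
    simp_rw [Finset.sum_mul]
  have hA := (deltab_den_pos b).ne'
  have hδ : 8 * (2 * cosh (2 * b) ^ 4 - sinh (2 * b) ^ 4) * deltab b = 8 * sinh (2 * b) ^ 4 := by
    rw [deltab]; field_simp
  rw [hsum, mul_add, mul_one, ← mul_assoc, hδ]
  have hsq := cosh_sq (2 * b)
  have h4 : cosh (4 * b) = cosh (2 * b) ^ 4 - sinh (2 * b) ^ 4 := by
    rw [show 4 * b = 2 * (2 * b) by ring, cosh_two_mul]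
    linear_combination (-cosh (2 * b) ^ 2 - sinh (2 * b) ^ 2) * hsq
  have h2n : cosh (-(2 * b)) = cosh (2 * b) := cosh_neg _
  have h4n : cosh (-(4 * b)) = cosh (4 * b) := cosh_neg _
  have key : ∀ a0 a1 a2 a3 : Bool, v 0 = a0 → v 1 = a1 → v 2 = a2 → v 3 = a3 →
      ∏ j : Fin 4, (2 * cosh (∑ i, (if i = j then b else -b) * spin (v i))) =
      8 * (2 * cosh (2 * b) ^ 4 - sinh (2 * b) ^ 4) +
        8 * sinh (2 * b) ^ 4 * (spin a0 * spin a1 * spin a2 * spin a3) := by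
    intro a0 a1 a2 a3 e0 e1 e2 e3
    simp only [Fin.prod_univ_four, Fin.sum_univ_four, e0, e1, e2, e3]
    cases a0 <;> cases a1 <;> cases a2 <;> cases a3 <;> simp [spin] <;> ring_nf <;>
      simp only [mul_comm b, h4, h2n, h4n] <;> ring_nf
  exact key _ _ _ _ rfl rfl rfl rfl

/-- Vertices of `H_{b[k]}` as shared vertices `w_i` and the six private vertices of each copy. -/
def vertexEquiv (k : ℕ) : Fin (k + 1) ⊕ Fin k × Fin 6 ≃ Fin (7 * k + 1) :=
  ((Equiv.sumCongr (Equiv.refl _) finProdFinEquiv).trans finSumFinEquiv).trans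
    (finCongr (by ring))

theorem vertexEquiv_inl_val {k : ℕ} (w : Fin (k + 1)) :
    (vertexEquiv k (Sum.inl w)).val = w.val := by
  simp [vertexEquiv]

theorem vertexEquiv_inr_val {k : ℕ} (c : Fin k) (r : Fin 6) :
    (vertexEquiv k (Sum.inr (c, r))).val = k + 1 + 6 * c.val + r.val := by
  simp [vertexEquiv]
  ring

theorem prod_focusSet {k : ℕ} (hk : 0 < k) (f : Fin (7 * k + 1) → ℝ) :
    ∏ i ∈ focusSet k, f i =
      f (vertexEquiv k (Sum.inl 0)) * f (vertexEquiv k (Sum.inl (Fin.last k))) *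
        ∏ c, f (vertexEquiv k (Sum.inr (c, 0))) * f (vertexEquiv k (Sum.inr (c, 1))) := by
  rw [focusSet, Finset.prod_filter, ← (vertexEquiv k).prod_comp, Fintype.prod_sum_type,
    Fintype.prod_prod_type]
  congr 1
  · have h : ∀ w : Fin (k + 1), ((vertexEquiv k (Sum.inl w)).val = 0 ∨
        (vertexEquiv k (Sum.inl w)).val = k ∨ ∃ c < k,
          (vertexEquiv k (Sum.inl w)).val = k + 1 + 6 * c ∨
          (vertexEquiv k (Sum.inl w)).val = k + 1 + 6 * c + 1) ↔
        w ∈ ({0, Fin.last k} : Finset (Fin (k + 1))) := by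
      intro w
      have := w.isLt
      simp only [vertexEquiv_inl_val, Finset.mem_insert, Finset.mem_singleton, Fin.ext_iff,
        Fin.val_zero, Fin.val_last]
      constructor
      · rintro (h | h | ⟨c, -, h | h⟩) <;> omega
      · rintro (h | h) <;> simp [h]
    simp_rw [h]
    rw [Finset.prod_ite_mem, Finset.univ_inter, Finset.prod_pair]
    simp only [ne_eq, Fin.ext_iff, Fin.val_zero, Fin.val_last]
    omega
  · refine Finset.prod_congr rfl fun c _ => ?_
    have h : ∀ r : Fin 6, ((vertexEquiv k (Sum.inr (c, r))).val = 0 ∨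
        (vertexEquiv k (Sum.inr (c, r))).val = k ∨ ∃ c' < k,
          (vertexEquiv k (Sum.inr (c, r))).val = k + 1 + 6 * c' ∨
          (vertexEquiv k (Sum.inr (c, r))).val = k + 1 + 6 * c' + 1) ↔
        r ∈ ({0, 1} : Finset (Fin 6)) := by
      intro r
      have := r.isLt
      simp only [vertexEquiv_inr_val, Finset.mem_insert, Finset.mem_singleton, Fin.ext_iff,
        Fin.val_zero, Fin.val_one]
      constructor
      · rintro (h | h | ⟨c', -, h | h⟩) <;> omega
      · rintro (h | h)
        · exact Or.inr (Or.inr ⟨c, c.isLt, Or.inl (by omega)⟩)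
        · exact Or.inr (Or.inr ⟨c, c.isLt, Or.inr (by omega)⟩)
    simp_rw [h]
    rw [Finset.prod_ite_mem, Finset.univ_inter, Finset.prod_pair (by decide)]

theorem vRole_eq {k : ℕ} (c : Fin k) :
    vRole k c = ![vertexEquiv k (Sum.inl c.castSucc), vertexEquiv k (Sum.inr (c, 0)),
      vertexEquiv k (Sum.inr (c, 1)), vertexEquiv k (Sum.inl c.succ)] := by
  funext i
  fin_cases i <;> simp [Fin.ext_iff, vRole, vertexEquiv_inl_val, vertexEquiv_inr_val]

theorem uRole_eq {k : ℕ} (c : Fin k) (j : Fin 4) :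
    uRole k c j = vertexEquiv k (Sum.inr (c, j.succ.succ)) := by
  simp [Fin.ext_iff, uRole, vertexEquiv_inr_val]
  ring

theorem vRole_ne_uRole {k : ℕ} (c c' : Fin k) (i j : Fin 4) : vRole k c i ≠ uRole k c' j := by
  rw [ne_eq, Fin.ext_iff]
  have := c.isLt
  fin_cases i <;> simp [vRole, uRole] <;> omega

/-- With zero biases the Ising weight on `H_{b[k]}` factors over the copies of `H_b`. -/
theorem isingWt_Hbk (b : ℝ) (k : ℕ) (σ : Fin (7 * k + 1) → Bool) :
    isingWt (Hbk b k) (fun _ => 0) σ =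
      ∏ c, exp (gadgetEnergy b (σ ∘ vRole k c) (σ ∘ uRole k c)) := by
  rw [← exp_sum, isingWt]
  congr 1
  have hterm : ∀ p q, spin (σ p) * Hbk b k p q * spin (σ q) =
      ∑ c : Fin k, ∑ i : Fin 4, ∑ j : Fin 4,
        ((if p = vRole k c i then if q = uRole k c j then
            (if i = j then b else -b) * spin (σ p) * spin (σ q) else 0 else 0) +
         (if p = uRole k c j then if q = vRole k c i then
            (if i = j then b else -b) * spin (σ p) * spin (σ q) else 0 else 0)) := by
    intro p q
    rw [Hbk, Finset.mul_sum, Finset.sum_mul]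
    refine Finset.sum_congr rfl fun c _ => ?_
    rw [Finset.mul_sum, Finset.sum_mul]
    refine Finset.sum_congr rfl fun i _ => ?_
    rw [Finset.mul_sum, Finset.sum_mul]
    refine Finset.sum_congr rfl fun j _ => ?_
    have hne := vRole_ne_uRole c c i j
    by_cases h1 : p = vRole k c i
    · have h2 : p ≠ uRole k c j := by rw [h1]; exact hne
      by_cases h3 : q = uRole k c j <;> simp only [h1, h3, hne, if_true, if_false, true_and,
        false_and, or_false] <;> ring
    · by_cases h2 : p = uRole k c j <;> by_cases h3 : q = vRole k c i <;>
        simp only [h1, h2, h3, hne.symm, if_true, if_false, true_and, false_and, and_false,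
          or_false, false_or] <;> ring
  simp_rw [hterm, Finset.sum_comm (s := (Finset.univ : Finset (Fin (7 * k + 1))))
      (t := (Finset.univ : Finset (Fin k))),
    Finset.sum_comm (s := (Finset.univ : Finset (Fin (7 * k + 1))))
      (t := (Finset.univ : Finset (Fin 4)))]
  simp only [Finset.sum_add_distrib, zero_mul, Finset.sum_const_zero, zero_add,
    Finset.sum_ite_irrel, Finset.sum_ite_eq', Finset.mem_univ, if_true, gadgetEnergy,
    Function.comp_apply, mul_right_comm _ (spin (σ (uRole _ _ _)))]
  ring

/-- Assemble a configuration from the shared spins and the private spins of each copy. -/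
def glue {k : ℕ} (w : Fin (k + 1) → Bool) (p : Fin k → Fin 6 → Bool) : Fin (7 * k + 1) → Bool :=
  fun v => Sum.elim w (fun cr => p cr.1 cr.2) ((vertexEquiv k).symm v)

@[simp]
theorem glue_inl {k : ℕ} (w : Fin (k + 1) → Bool) (p : Fin k → Fin 6 → Bool) (i : Fin (k + 1)) :
    glue w p (vertexEquiv k (Sum.inl i)) = w i := by
  simp [glue]

@[simp]
theorem glue_inr {k : ℕ} (w : Fin (k + 1) → Bool) (p : Fin k → Fin 6 → Bool) (c : Fin k)
    (r : Fin 6) : glue w p (vertexEquiv k (Sum.inr (c, r))) = p c r := by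
  simp [glue]

theorem sum_config {k : ℕ} (F : (Fin (7 * k + 1) → Bool) → ℝ) :
    ∑ σ, F σ = ∑ w, ∑ p, F (glue w p) := by
  let e : (Fin (k + 1) → Bool) × (Fin k → Fin 6 → Bool) ≃ (Fin (7 * k + 1) → Bool) :=
    ((Equiv.prodCongr (Equiv.refl _) (Equiv.curry _ _ _).symm).trans
      (Equiv.sumArrowEquivProdArrow _ _ _).symm).trans
      (Equiv.arrowCongr (vertexEquiv k) (Equiv.refl Bool))
  rw [← e.sum_comp, Fintype.sum_prod_type]
  rfl

/-- Weighted sum over the private spins of a copy of `H_b`, given its two shared spins. -/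
theorem sum_gadget (b : ℝ) (f g : Bool → ℝ) (a a' : Bool) :
    ∑ q : Fin 6 → Bool, f (q 0) * g (q 1) *
        exp (gadgetEnergy b ![a, q 0, q 1, a'] (fun j => q j.succ.succ)) =
      8 * (2 * cosh (2 * b) ^ 4 - sinh (2 * b) ^ 4) *
        ((∑ s, f s) * (∑ s, g s) +
          deltab b * ((∑ s, spin s * f s) * ∑ s, spin s * g s) * spin a * spin a') := by
  rw [sum_fin_succ_fun]
  simp_rw [sum_fin_succ_fun (n := 4)]
  have h1 : ∀ (s t : Bool) (u : Fin 4 → Bool),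
      (Fin.cons s (Fin.cons t u : Fin 5 → Bool) : Fin 6 → Bool) 1 = t := fun _ _ _ => rfl
  simp only [Fin.cons_zero, Fin.cons_succ, h1, ← Finset.mul_sum, sum_exp_gadgetEnergy]
  cases a <;> cases a' <;> simp [spin] <;> ring

/-- The unnormalized expectation of a product of functions of the focus spins. -/
theorem sum_prod_focusSet_mul_isingWt (b : ℝ) {k : ℕ} (hk : 0 < k)
    (φ : Fin (7 * k + 1) → Bool → ℝ) :
    ∑ σ, (∏ i ∈ focusSet k, φ i (σ i)) * isingWt (Hbk b k) (fun _ => 0) σ =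
      (8 * (2 * cosh (2 * b) ^ 4 - sinh (2 * b) ^ 4)) ^ k * (2 ^ k / 2) *
        (∏ i ∈ focusSet k, ∑ s, φ i s +
          deltab b ^ k * ∏ i ∈ focusSet k, ∑ s, spin s * φ i s) := by
  have hv : ∀ (w : Fin (k + 1) → Bool) (p : Fin k → Fin 6 → Bool) (c : Fin k),
      glue w p ∘ vRole k c = ![w c.castSucc, p c 0, p c 1, w c.succ] := by
    intro w p c
    rw [vRole_eq]
    funext i
    fin_cases i <;> simp
  have hu : ∀ (w : Fin (k + 1) → Bool) (p : Fin k → Fin 6 → Bool) (c : Fin k),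
      glue w p ∘ uRole k c = fun j => p c j.succ.succ := by
    intro w p c
    funext j
    simp [uRole_eq]
  rw [sum_config]
  simp_rw [isingWt_Hbk, prod_focusSet hk, glue_inl, glue_inr, hv, hu, mul_assoc _ (∏ c, _) (∏ c, _),
    ← Finset.prod_mul_distrib, ← Finset.mul_sum]
  have hp : ∀ w : Fin (k + 1) → Bool,
      ∑ p : Fin k → Fin 6 → Bool, ∏ c : Fin k,
        φ (vertexEquiv k (Sum.inr (c, 0))) (p c 0) * φ (vertexEquiv k (Sum.inr (c, 1))) (p c 1) *
          exp (gadgetEnergy b ![w c.castSucc, p c 0, p c 1, w c.succ]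
            (fun j => p c j.succ.succ)) =
      (8 * (2 * cosh (2 * b) ^ 4 - sinh (2 * b) ^ 4)) ^ k * ∏ c : Fin k,
        ((∑ s, φ (vertexEquiv k (Sum.inr (c, 0))) s) * (∑ s, φ (vertexEquiv k (Sum.inr (c, 1))) s) +
          deltab b * ((∑ s, spin s * φ (vertexEquiv k (Sum.inr (c, 0))) s) *
            ∑ s, spin s * φ (vertexEquiv k (Sum.inr (c, 1))) s) *
            spin (w c.castSucc) * spin (w c.succ)) := by
    intro w
    rw [← Fin.prod_const, ← Finset.prod_mul_distrib]
    simp_rw [← sum_gadget]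
    rw [Finset.prod_univ_sum, Fintype.piFinset_univ]
  simp_rw [hp, mul_left_comm _ ((8 * (2 * cosh (2 * b) ^ 4 - sinh (2 * b) ^ 4)) ^ k)]
  rw [← Finset.mul_sum, sum_spin_chain, Finset.prod_mul_distrib (f := fun _ => deltab b),
    Fin.prod_const]
  ring

theorem two_pow_card_focusSet {k : ℕ} (hk : 0 < k) : (2 : ℝ) ^ (focusSet k).card = 2 ^ (2 * k + 2) := by
  rw [← Finset.prod_const, prod_focusSet hk, Fin.prod_const, pow_add, pow_mul]
  norm_num
  ring

/-- For the Ising model on `H_{b[k]}` with zero biases, the probability that the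
focus vertices take prescribed values `x` is `2^{-(2k+2)}(1 + δ_b^k ∏ x_i)`. -/
theorem stmt8 (b : ℝ) (hb : 0 < b) (k : ℕ) (hk : 0 < k) (x : Fin (7 * k + 1) → Bool) :
    isingPr (Hbk b k) (fun _ => 0) (fun σ => ∀ i ∈ focusSet k, σ i = x i) =
      ((2 : ℝ) ^ (2 * k + 2))⁻¹ * (1 + deltab b ^ k * ∏ i ∈ focusSet k, spin (x i)) := by
  set A := (8 * (2 * cosh (2 * b) ^ 4 - sinh (2 * b) ^ 4)) ^ k * ((2 : ℝ) ^ k / 2) with hA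
  have hA0 : A ≠ 0 := by
    have := deltab_den_pos b
    positivity
  have hZ : ∑ τ, isingWt (Hbk b k) (fun _ => 0) τ = A * 2 ^ (2 * k + 2) := by
    have h := sum_prod_focusSet_mul_isingWt b hk (fun _ _ => 1)
    have hzero : ∏ i ∈ focusSet k, ∑ s, spin s * (1 : ℝ) = 0 := by
      rw [prod_focusSet hk]
      simp [spin]
    rw [hzero] at h
    simpa [two_pow_card_focusSet hk, ← hA] using h
  have hN := sum_prod_focusSet_mul_isingWt b hk (fun i s => if s = x i then 1 else 0)
  simp_rw [Finset.prod_ite_zero, Finset.prod_const_one, ite_mul, one_mul, zero_mul] at hN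
  rw [isingPr, Finset.sum_filter]
  simp_rw [isingProb, hZ]
  have : ∀ σ : Fin (7 * k + 1) → Bool, (if ∀ i ∈ focusSet k, σ i = x i then
      isingWt (Hbk b k) (fun _ => 0) σ / (A * 2 ^ (2 * k + 2)) else 0) =
      (if ∀ i ∈ focusSet k, σ i = x i then isingWt (Hbk b k) (fun _ => 0) σ else 0) /
        (A * 2 ^ (2 * k + 2)) := by
    intro σ
    split_ifs <;> simp
  simp_rw [this]
  rw [← Finset.sum_div, hN, ← hA]
  simp only [Finset.sum_ite_eq', Finset.mem_univ, if_true, Finset.prod_const_one, mul_ite, mul_one,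
    mul_zero]
  field_simp
end
end
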